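/- arXiv:2409.18175 — 3 statements merged into one kernel-verified Lean document; each statement's English description precedes it below -/
import Mathlib

section
/- For every n ≥ 1, the automorphism group Aut(B_n) is generated by the following permutations of the 3n coordinates (indexing coordinates 1,…,3n): the transpositions (i, n+i) for 1 ≤ i ≤ n, the transpositions (n+i, 2n+i) for 1 ≤ i ≤ n, and the products (i,j)(n+i,n+j)(2n+i,2n+j) for 1 ≤ i < j ≤ n. -/
/-- The group of permutation automorphisms of a binary linear code `C ⊆ F₂^ι`:
permutations of the coordinate positions that map the code onto itself. -/
def codeAut {ι : Type*} (C : Submodule (ZMod 2) (ι → ZMod 2)) :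
    Subgroup (Equiv.Perm ι) where
  carrier := {σ | ∀ v : ι → ZMod 2, v ∈ C ↔ v ∘ ⇑σ ∈ C}
  one_mem' := by
    simp only [Set.mem_setOf_eq]
    intro v
    simp
  mul_mem' := by
    intro a b ha hb
    simp only [Set.mem_setOf_eq] at *
    intro v
    have h : v ∘ ⇑(a * b) = (v ∘ ⇑a) ∘ ⇑b := by
      funext x
      simp [Function.comp, Equiv.Perm.mul_apply]
    rw [h]
    exact (ha v).trans (hb (v ∘ ⇑a))
  inv_mem' := by
    intro a ha
    simp only [Set.mem_setOf_eq] at *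
    intro v
    have h := ha (v ∘ ⇑a⁻¹)
    have h2 : (v ∘ ⇑a⁻¹) ∘ ⇑a = v := by
      funext x
      simp
    rw [h2] at h
    exact h.symm

/-- The binary linear code `B_n ⊆ F₂^{3n}` spanned by the `n` vectors
`g_i = (e_i | e_i | e_i)`; the `3n` coordinates are indexed by `Fin 3 × Fin n`,
where `(a, i)` is the coordinate in position `i` of the `a`-th block of `n`. -/
def Bcode (n : ℕ) : Submodule (ZMod 2) (Fin 3 × Fin n → ZMod 2) :=
  Submodule.span (ZMod 2)
    (Set.range fun i : Fin n =>
      fun c : Fin 3 × Fin n => if c.2 = i then (1 : ZMod 2) else 0)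

theorem mem_Bcode_iff {n : ℕ} {v : Fin 3 × Fin n → ZMod 2} :
    v ∈ Bcode n ↔ ∀ c d, c.2 = d.2 → v c = v d := by
  constructor
  · intro hv c d hcd
    induction hv using Submodule.span_induction with
    | mem x hx =>
      obtain ⟨i, rfl⟩ := hx
      simp [hcd]
    | zero => rfl
    | add x y _ _ hx hy => simp [hx, hy]
    | smul a x _ hx => simp [hx]
  · intro hv
    have hsum : v = ∑ i : Fin n, v (0, i) •
        fun c : Fin 3 × Fin n => if c.2 = i then (1 : ZMod 2) else 0 := by
      funext c
      simpa using hv c (0, c.2) rfl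
    rw [hsum]
    exact Submodule.sum_mem _ fun i _ =>
      Submodule.smul_mem _ _ (Submodule.subset_span ⟨i, rfl⟩)

/-- An automorphism of `B_n` permutes the blocks `{(0, i), (1, i), (2, i)}`. -/
theorem snd_apply_eq_of_mem_codeAut {n : ℕ} {σ : Equiv.Perm (Fin 3 × Fin n)}
    (hσ : σ ∈ codeAut (Bcode n)) {c d : Fin 3 × Fin n} (h : c.2 = d.2) :
    (σ c).2 = (σ d).2 := by
  have hmem : (fun x : Fin 3 × Fin n => if x.2 = (σ c).2 then (1 : ZMod 2) else 0) ∈ Bcode n :=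
    Submodule.subset_span ⟨(σ c).2, rfl⟩
  have heq := mem_Bcode_iff.1 ((hσ _).1 hmem) c d h
  by_contra hne
  simp [Ne.symm hne] at heq

theorem mem_codeAut_Bcode_of_snd_apply {n : ℕ} {σ : Equiv.Perm (Fin 3 × Fin n)}
    (τ : Equiv.Perm (Fin n)) (h : ∀ c, (σ c).2 = τ c.2) : σ ∈ codeAut (Bcode n) := by
  intro v
  simp only [mem_Bcode_iff, Function.comp_apply]
  constructor
  · intro hv c d hcd
    exact hv _ _ (by rw [h, h, hcd])
  · intro hv c d hcd
    have hinv : (σ.symm c).2 = (σ.symm d).2 := τ.injective (by simp [← h, hcd])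
    simpa using hv _ _ hinv

/-- Permute the positions simultaneously in every block. -/
def permBlocks (α ι : Type*) : Equiv.Perm ι →* Equiv.Perm (α × ι) where
  toFun τ := Equiv.prodCongr (Equiv.refl α) τ
  map_one' := rfl
  map_mul' _ _ := rfl

/-- Permute the coordinates inside the fibre over each position. -/
def permFibres (α ι : Type*) : (ι → Equiv.Perm α) →* Equiv.Perm (α × ι) where
  toFun g := Equiv.prodCongrLeft g
  map_one' := rfl
  map_mul' _ _ := rfl

theorem permBlocks_apply {α ι : Type*} (τ : Equiv.Perm ι) (c : α × ι) :
    permBlocks α ι τ c = (c.1, τ c.2) := rfl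

theorem permFibres_apply {α ι : Type*} (g : ι → Equiv.Perm α) (c : α × ι) :
    permFibres α ι g c = (g c.2 c.1, c.2) := rfl

theorem permBlocks_swap {ι : Type*} [DecidableEq ι] (i j : ι) :
    permBlocks (Fin 3) ι (Equiv.swap i j) =
      Equiv.swap (0, i) (0, j) * Equiv.swap (1, i) (1, j) * Equiv.swap (2, i) (2, j) := by
  ext1 ⟨a, k⟩
  rw [permBlocks_apply]
  by_cases hi : k = i
  · subst hi
    fin_cases a <;> simp [Equiv.swap_apply_def]
  · by_cases hj : k = j
    · subst hj
      fin_cases a <;> simp [Equiv.swap_apply_def]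
    · simp [Equiv.swap_apply_def, hi, hj]

theorem permFibres_mulSingle_swap {α ι : Type*} [DecidableEq α] [DecidableEq ι]
    (i : ι) (a b : α) :
    permFibres α ι (Pi.mulSingle i (Equiv.swap a b)) = Equiv.swap (a, i) (b, i) := by
  ext1 ⟨x, k⟩
  rw [permFibres_apply]
  by_cases hk : k = i
  · subst hk
    simp only [Pi.mulSingle_eq_same, Equiv.swap_apply_def, Prod.mk.injEq, and_true]
    split_ifs <;> rfl
  · simp [Equiv.swap_apply_def, hk]

theorem exists_eq_permBlocks_mul_permFibres {α ι : Type*} [Finite α] [Finite ι] [Nonempty α]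
    {σ : Equiv.Perm (α × ι)} (hσ : ∀ c d, c.2 = d.2 → (σ c).2 = (σ d).2) :
    ∃ τ g, σ = permBlocks α ι τ * permFibres α ι g := by
  obtain ⟨a⟩ := ‹Nonempty α›
  have hsnd : ∀ c, (σ c).2 = (σ (a, c.2)).2 := fun c => hσ _ _ rfl
  have hτ : Function.Bijective fun i => (σ (a, i)).2 := by
    refine Finite.injective_iff_bijective.1 (Finite.injective_iff_surjective.2 fun j => ?_)
    exact ⟨(σ.symm (a, j)).2, by simp [← hsnd]⟩
  have hg : ∀ i, Function.Bijective fun x => (σ (x, i)).1 := by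
    refine fun i => Finite.injective_iff_bijective.1 fun x y hxy => ?_
    exact congrArg Prod.fst (σ.injective (Prod.ext hxy (hσ (x, i) (y, i) rfl)))
  refine ⟨Equiv.ofBijective _ hτ, fun i => Equiv.ofBijective _ (hg i), ?_⟩
  ext1 c
  exact Prod.ext rfl (hsnd c)

theorem permBlocks_mem {n : ℕ} {H : Subgroup (Equiv.Perm (Fin 3 × Fin n))}
    (h : ∀ i j : Fin n, i < j → Equiv.swap ((0 : Fin 3), i) (0, j) *
      Equiv.swap (1, i) (1, j) * Equiv.swap (2, i) (2, j) ∈ H) (τ : Equiv.Perm (Fin n)) :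
    permBlocks (Fin 3) (Fin n) τ ∈ H := by
  induction τ using Equiv.Perm.swap_induction_on with
  | one => simp
  | swap_mul f x y hxy hf =>
    rw [map_mul]
    refine H.mul_mem ?_ hf
    rcases hxy.lt_or_gt with hlt | hlt
    · rw [permBlocks_swap]
      exact h x y hlt
    · rw [Equiv.swap_comm, permBlocks_swap]
      exact h y x hlt

theorem permFibres_mem {ι : Type*} [Finite ι] [DecidableEq ι]
    {H : Subgroup (Equiv.Perm (Fin 3 × ι))}
    (h₀₁ : ∀ i : ι, Equiv.swap ((0 : Fin 3), i) (1, i) ∈ H)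
    (h₁₂ : ∀ i : ι, Equiv.swap ((1 : Fin 3), i) (2, i) ∈ H) (g : ι → Equiv.Perm (Fin 3)) :
    permFibres (Fin 3) ι g ∈ H := by
  refine Subgroup.pi_mem_of_mulSingle_mem (H := H.comap (permFibres (Fin 3) ι)) g fun i => ?_
  generalize g i = p
  have hp : p ∈ Submonoid.closure
      (Set.range fun k : Fin 2 => Equiv.swap k.castSucc k.succ) := by
    rw [Equiv.Perm.mclosure_swap_castSucc_succ]
    trivial
  induction hp using Submonoid.closure_induction with
  | mem p hp =>
    obtain ⟨k, rfl⟩ := hp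
    rw [Subgroup.mem_comap, permFibres_mulSingle_swap]
    fin_cases k
    · exact h₀₁ i
    · exact h₁₂ i
  | one => simp
  | mul p q _ _ hp hq =>
    rw [Pi.mulSingle_mul]
    exact Subgroup.mul_mem _ hp hq

/-- For every `n ≥ 1`, `Aut(B_n)` is generated by: the transpositions `(i, n+i)`
(here `(0,i) ↔ (1,i)`), the transpositions `(n+i, 2n+i)` (here `(1,i) ↔ (2,i)`),
and the products `(i,j)(n+i,n+j)(2n+i,2n+j)` for `i < j`. -/
theorem aut_Bn_generators (n : ℕ) (hn : 1 ≤ n) :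
    codeAut (Bcode n) = Subgroup.closure
      ({σ : Equiv.Perm (Fin 3 × Fin n) | ∃ i : Fin n,
          σ = Equiv.swap ((0 : Fin 3), i) ((1 : Fin 3), i)} ∪
       {σ : Equiv.Perm (Fin 3 × Fin n) | ∃ i : Fin n,
          σ = Equiv.swap ((1 : Fin 3), i) ((2 : Fin 3), i)} ∪
       {σ : Equiv.Perm (Fin 3 × Fin n) | ∃ i j : Fin n, i < j ∧
          σ = Equiv.swap ((0 : Fin 3), i) ((0 : Fin 3), j) *
              Equiv.swap ((1 : Fin 3), i) ((1 : Fin 3), j) *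
              Equiv.swap ((2 : Fin 3), i) ((2 : Fin 3), j)}) := by
  apply le_antisymm
  · intro σ hσ
    obtain ⟨τ, g, rfl⟩ := exists_eq_permBlocks_mul_permFibres
      fun _ _ => snd_apply_eq_of_mem_codeAut hσ
    refine Subgroup.mul_mem _ (permBlocks_mem (fun i j hij => ?_) τ)
      (permFibres_mem (fun i => ?_) (fun i => ?_) g)
    · exact Subgroup.subset_closure (Or.inr ⟨i, j, hij, rfl⟩)
    · exact Subgroup.subset_closure (Or.inl (Or.inl ⟨i, rfl⟩))
    · exact Subgroup.subset_closure (Or.inl (Or.inr ⟨i, rfl⟩))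
  · rw [Subgroup.closure_le]
    rintro σ ((⟨i, rfl⟩ | ⟨i, rfl⟩) | ⟨i, j, -, rfl⟩)
    · rw [← permFibres_mulSingle_swap]
      exact mem_codeAut_Bcode_of_snd_apply 1 fun _ => rfl
    · rw [← permFibres_mulSingle_swap]
      exact mem_codeAut_Bcode_of_snd_apply 1 fun _ => rfl
    · rw [← permBlocks_swap]
      exact mem_codeAut_Bcode_of_snd_apply (Equiv.swap i j) fun _ => rfl
end

section
/- Every symplectic 2n×2n matrix U over F₂ can be written as a product U = U_A · U_B · U_C · U_H, where: U_A = [[I, 0], [A, I]] for some symmetric n×n binary matrix A; U_B = [[I, B], [0, I]] for some symmetric n×n binary matrix B; U_C = [[C, 0], [0, (C⁻¹)ᵀ]] for some invertible n×n binary matrix C; and U_H = [[diag(1+h), diag(h)], [diag(h), diag(1+h)]] for some vector h ∈ F₂^n, where diag(v) denotes the diagonal matrix with diagonal entries given by v and 1+h denotes the coordinatewise complement of h. -/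
open Matrix

/-- The binary symplectic form `Ω = [[0, I], [I, 0]]` on `F₂^{2n}`. -/
def Omg (n : ℕ) : Matrix (Fin n ⊕ Fin n) (Fin n ⊕ Fin n) (ZMod 2) :=
  fromBlocks 0 1 1 0

/-- The matrix `U_H(h) = [[diag(1+h), diag(h)], [diag(h), diag(1+h)]]`
corresponding to a layer of Hadamard gates on the qubits in the support of `h`. -/
def UHmat (n : ℕ) (h : Fin n → ZMod 2) :
    Matrix (Fin n ⊕ Fin n) (Fin n ⊕ Fin n) (ZMod 2) :=
  fromBlocks (diagonal (1 + h)) (diagonal h) (diagonal h) (diagonal (1 + h))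

namespace SymplecticDecomposition

theorem eq_of_add_eq_zero {m n : Type*} {M N : Matrix m n (ZMod 2)} (h : M + N = 0) :
    M = N := by
  ext i j
  exact CharTwo.add_eq_zero.mp (congrFun (congrFun h i) j)

theorem UHmat_mul_self (n : ℕ) (h : Fin n → ZMod 2) : UHmat n h * UHmat n h = 1 := by
  have h1 : ∀ x : ZMod 2, (1 + x) * (1 + x) + x * x = 1 := by decide
  have h2 : ∀ x : ZMod 2, (1 + x) * x + x * (1 + x) = 0 := by decide
  have h3 : ∀ x : ZMod 2, x * (1 + x) + (1 + x) * x = 0 := by decide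
  have h4 : ∀ x : ZMod 2, x * x + (1 + x) * (1 + x) = 1 := by decide
  simp [UHmat, fromBlocks_multiply, diagonal_mul_diagonal, diagonal_add, h1, h2, h3, h4]

theorem UHmat_transpose (n : ℕ) (h : Fin n → ZMod 2) : (UHmat n h)ᵀ = UHmat n h := by
  simp [UHmat, fromBlocks_transpose]

theorem UHmat_mul_Omg (n : ℕ) (h : Fin n → ZMod 2) :
    UHmat n h * Omg n = Omg n * UHmat n h := by
  simp [UHmat, Omg, fromBlocks_multiply]

theorem Omg_mul_self (n : ℕ) : Omg n * Omg n = 1 := by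
  simp [Omg, fromBlocks_multiply]

/-- The transpose of a symplectic matrix is symplectic. -/
theorem transpose_mul_Omg_mul {n : ℕ} {U : Matrix (Fin n ⊕ Fin n) (Fin n ⊕ Fin n) (ZMod 2)}
    (hU : U * Omg n * Uᵀ = Omg n) : Uᵀ * Omg n * U = Omg n := by
  have h1 : U * (Omg n * Uᵀ * Omg n) = 1 := by
    rw [← Omg_mul_self n, ← mul_assoc, ← mul_assoc, hU]
  have h2 : Omg n * (Uᵀ * Omg n * U) = 1 := by
    rw [← mul_eq_one_comm.mp h1]
    simp only [mul_assoc]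
  calc Uᵀ * Omg n * U = Omg n * Omg n * (Uᵀ * Omg n * U) := by rw [Omg_mul_self, one_mul]
    _ = Omg n := by rw [mul_assoc, h2, mul_one]

/-- Some set of columns of a matrix forms a basis of its column space: a row vector orthogonal
to these columns is orthogonal to all columns, and the columns are linearly independent. -/
theorem exists_column_basis {K m n : Type*} [Field K] [Fintype m] [Fintype n]
    (X : Matrix m n K) :
    ∃ S : Set n, (∀ v : m → K, (∀ i ∈ S, (v ᵥ* X) i = 0) → v ᵥ* X = 0) ∧
      ∀ w : n → K, (∀ i ∉ S, w i = 0) → X *ᵥ w = 0 → w = 0 := by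
  classical
  obtain ⟨κ, a, ha, hspan, hli⟩ := exists_linearIndependent' K X.col
  refine ⟨Set.range a, fun v hv => ?_, fun w hw hXw => ?_⟩
  · have key : Submodule.span K (Set.range X.col) ≤
        LinearMap.ker (dotProductBilin K K v) := by
      rw [← hspan, Submodule.span_le]
      rintro _ ⟨k, rfl⟩
      exact hv (a k) ⟨k, rfl⟩
    ext i
    exact key (Submodule.subset_span ⟨i, rfl⟩)
  · have : Fintype κ := Fintype.ofInjective a ha
    have hsum : ∑ k, w (a k) • (X.col ∘ a) k = 0 := by
      rw [← hXw]
      ext j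
      simp only [Finset.sum_apply, Pi.smul_apply, Function.comp_apply, smul_eq_mul, mulVec,
        dotProduct, col_apply]
      rw [← Finset.sum_subset (Finset.subset_univ (Finset.univ.image a)),
        Finset.sum_image (fun _ _ _ _ e => ha e)]
      · exact Finset.sum_congr rfl fun _ _ => mul_comm _ _
      · intro i _ hi
        rw [hw i (by simpa using hi), mul_zero]
    ext i
    by_cases hi : i ∈ Set.range a
    · obtain ⟨k, rfl⟩ := hi
      exact Fintype.linearIndependent_iff.mp hli _ hsum k
    · exact hw i hi

/-- For a pair of matrices spanning a Lagrangian subspace, swapping suitable columns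
makes the first one invertible. -/
theorem exists_isUnit_swap {n : ℕ} {X Z P Q : Matrix (Fin n) (Fin n) (ZMod 2)}
    (hXZ : X * Zᵀ = Z * Xᵀ) (hone : X * Qᵀ + Z * Pᵀ = 1) :
    ∃ h : Fin n → ZMod 2, IsUnit (X * diagonal (1 + h) + Z * diagonal h) := by
  classical
  obtain ⟨S, hS, hS'⟩ := exists_column_basis X
  refine ⟨fun i => if i ∈ S then 0 else 1, ?_⟩
  rw [← vecMul_injective_iff_isUnit, ← coe_vecMulLinear, ← LinearMap.ker_eq_bot,
    LinearMap.ker_eq_bot']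
  intro v hv
  have hv' : ∀ i, (v ᵥ* X) i * (1 + if i ∈ S then 0 else 1) +
      (v ᵥ* Z) i * (if i ∈ S then 0 else 1) = 0 := by
    intro i
    have := congrFun hv i
    simpa only [vecMulLinear_apply, vecMul_add, ← vecMul_vecMul, Pi.add_apply,
      vecMul_diagonal, Pi.one_apply, Pi.zero_apply] using this
  have hvX : v ᵥ* X = 0 := hS v fun i hi => by simpa [hi] using hv' i
  have hvZ : v ᵥ* Z = 0 := by
    refine hS' _ (fun i hi => by simpa [hi, hvX] using hv' i) ?_
    rw [← vecMul_transpose, vecMul_vecMul, ← hXZ, ← vecMul_vecMul, hvX, zero_vecMul]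
  rw [← vecMul_one v, ← hone, vecMul_add, ← vecMul_vecMul, ← vecMul_vecMul, hvX, hvZ]
  simp

/-- A symplectic matrix with invertible upper left block is a product of a lower triangular,
an upper triangular and a block diagonal symplectic matrix. -/
theorem decomposition_of_isUnit {n : ℕ} {E F G H : Matrix (Fin n) (Fin n) (ZMod 2)}
    (hV : fromBlocks E F G H * Omg n * (fromBlocks E F G H)ᵀ = Omg n) (hE : IsUnit E) :
    (G * E⁻¹)ᵀ = G * E⁻¹ ∧ (F * Eᵀ)ᵀ = F * Eᵀ ∧
      fromBlocks E F G H = fromBlocks 1 0 (G * E⁻¹) 1 * fromBlocks 1 (F * Eᵀ) 0 1 *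
        fromBlocks E 0 0 (E⁻¹)ᵀ := by
  have hV' := transpose_mul_Omg_mul hV
  simp only [Omg, fromBlocks_transpose, fromBlocks_multiply, mul_zero, mul_one, zero_add,
    add_zero, fromBlocks_inj] at hV hV'
  obtain ⟨hFE, -, hHE, -⟩ := hV
  have hGE := hV'.1
  have hdet : IsUnit E.det := (isUnit_iff_isUnit_det E).mp hE
  have hEE : E * E⁻¹ = 1 := mul_nonsing_inv E hdet
  have hEE' : E⁻¹ * E = 1 := nonsing_inv_mul E hdet
  have hET : Eᵀ * (E⁻¹)ᵀ = 1 := by rw [← transpose_mul, hEE', transpose_one]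
  have hET' : (E⁻¹)ᵀ * Eᵀ = 1 := by rw [← transpose_mul, hEE, transpose_one]
  have hFE : F * Eᵀ = E * Fᵀ := eq_of_add_eq_zero hFE
  have hGE : Gᵀ * E = Eᵀ * G := eq_of_add_eq_zero hGE
  have hHE : H * Eᵀ = 1 + G * Fᵀ := by
    ext i j
    rw [← hHE, Matrix.add_apply, Matrix.add_apply, add_assoc, CharTwo.add_self_eq_zero, add_zero]
  refine ⟨?_, ?_, ?_⟩
  · calc (G * E⁻¹)ᵀ = (E⁻¹)ᵀ * (Gᵀ * E) * E⁻¹ := by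
          rw [transpose_mul, mul_assoc, mul_assoc, hEE, mul_one]
      _ = G * E⁻¹ := by rw [hGE, ← mul_assoc, hET', one_mul]
  · rw [transpose_mul, transpose_transpose, hFE]
  · simp only [fromBlocks_multiply, mul_zero, mul_one, one_mul, zero_add, add_zero,
      fromBlocks_inj]
    refine ⟨trivial, ?_, ?_, ?_⟩
    · rw [mul_assoc, hET, mul_one]
    · rw [mul_assoc, hEE', mul_one]
    · calc H = H * Eᵀ * (E⁻¹)ᵀ := by rw [mul_assoc, hET, mul_one]
        _ = (G * E⁻¹ * (F * Eᵀ) + 1) * (E⁻¹)ᵀ := by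
          rw [hHE, hFE, mul_assoc G, ← mul_assoc E⁻¹, hEE', one_mul, add_comm]

end SymplecticDecomposition

open SymplecticDecomposition in
/-- Every symplectic `2n×2n` matrix `U` over `F₂` can be written as
`U = U_A · U_B · U_C · U_H` with `U_A = [[I,0],[A,I]]` (`A` symmetric),
`U_B = [[I,B],[0,I]]` (`B` symmetric), `U_C = [[C,0],[0,(C⁻¹)ᵀ]]` (`C` invertible),
and `U_H = U_H(h)` for some `h ∈ F₂^n`. -/
theorem symplectic_decomposition (n : ℕ)
    (U : Matrix (Fin n ⊕ Fin n) (Fin n ⊕ Fin n) (ZMod 2))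
    (hU : U * Omg n * Uᵀ = Omg n) :
    ∃ (A B C : Matrix (Fin n) (Fin n) (ZMod 2)) (h : Fin n → ZMod 2),
      Aᵀ = A ∧ Bᵀ = B ∧ IsUnit C ∧
      U = fromBlocks 1 0 A 1 * fromBlocks 1 B 0 1 *
          fromBlocks C 0 0 (C⁻¹)ᵀ * UHmat n h := by
  obtain ⟨X, Z, P, Q, rfl⟩ : ∃ X Z P Q, U = fromBlocks X Z P Q :=
    ⟨_, _, _, _, (fromBlocks_toBlocks U).symm⟩
  have hblocks := hU
  simp only [Omg, fromBlocks_transpose, fromBlocks_multiply, mul_zero, mul_one, zero_add,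
    add_zero, fromBlocks_inj] at hblocks
  obtain ⟨hXZ, hone, -, -⟩ := hblocks
  obtain ⟨h, hE⟩ := exists_isUnit_swap (X := X) (Z := Z) (P := P) (Q := Q)
    (eq_of_add_eq_zero hXZ).symm (by rw [add_comm]; exact hone)
  have hV : fromBlocks X Z P Q * UHmat n h * Omg n * (fromBlocks X Z P Q * UHmat n h)ᵀ =
      Omg n := by
    rw [transpose_mul, UHmat_transpose, mul_assoc (fromBlocks X Z P Q), UHmat_mul_Omg,
      mul_assoc, mul_assoc, ← mul_assoc (UHmat n h), UHmat_mul_self, one_mul, ← mul_assoc, hU]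
  have hVblocks : fromBlocks X Z P Q * UHmat n h =
      fromBlocks (X * diagonal (1 + h) + Z * diagonal h) (X * diagonal h + Z * diagonal (1 + h))
        (P * diagonal (1 + h) + Q * diagonal h) (P * diagonal h + Q * diagonal (1 + h)) := by
    rw [UHmat, fromBlocks_multiply]
  rw [hVblocks] at hV
  obtain ⟨hA, hB, hprod⟩ := decomposition_of_isUnit hV hE
  refine ⟨_, _, _, h, hA, hB, hE, ?_⟩
  rw [← hprod, ← hVblocks, mul_assoc, UHmat_mul_self, mul_one]
end

section
/- For every symplectic 2n×2n matrix U over F₂ there exists a vector h ∈ F₂^n such that the top-left n×n block of the product U · U_H(h) is invertible, where U_H(h) = [[diag(1+h), diag(h)], [diag(h), diag(1+h)]], diag(v) denotes the diagonal matrix with diagonal entries given by v, and 1+h denotes the coordinatewise complement of h. -/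
open Matrix

/-- If the rows of `[A | B]` are linearly independent and `A * Bᵀ` is symmetric, then for a
column basis `s` of `A`, the columns of `A` in `s` together with the columns of `B` outside `s`
form a matrix with trivial left kernel. -/
theorem exists_columns_vecMul_eq_zero_imp {K ι : Type*} [Field K] [Fintype ι]
    (A B : Matrix ι ι K) (hsymm : A * Bᵀ = B * Aᵀ)
    (hrows : ∀ x : ι → K, x ᵥ* A = 0 → x ᵥ* B = 0 → x = 0) :
    ∃ s : Set ι, ∀ x : ι → K,
      (∀ j ∈ s, (x ᵥ* A) j = 0) → (∀ j ∉ s, (x ᵥ* B) j = 0) → x = 0 := by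
  obtain ⟨s, -, -, hspan, hind⟩ :=
    exists_linearIndepOn_extension (K := K) (v := A.col) (linearIndepOn_empty K A.col)
      (Set.empty_subset Set.univ)
  refine ⟨s, fun x hA hB => ?_⟩
  have hxA : x ᵥ* A = 0 := by
    funext j
    have hle : Submodule.span K (A.col '' s) ≤ LinearMap.ker (dotProductBilin K K x) := by
      rw [Submodule.span_le]
      rintro _ ⟨i, hi, rfl⟩
      exact hA i hi
    exact hle (hspan ⟨j, Set.mem_univ j, rfl⟩)
  refine hrows x hxA ?_
  have hker : A *ᵥ (x ᵥ* B) = 0 := by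
    rw [← vecMul_transpose, vecMul_vecMul, ← hsymm, ← vecMul_vecMul, hxA, zero_vecMul]
  have hsupp : (Finsupp.linearEquivFunOnFinite K K ι).symm (x ᵥ* B) ∈ Finsupp.supported K K s := by
    rw [Finsupp.mem_supported']
    exact hB
  have hzero := linearIndepOn_iff.1 hind _ hsupp (by
    rw [Finsupp.linearCombination_eq_fintype_linearCombination_apply K,
      Fintype.linearCombination_apply]
    funext i
    simpa [mulVec, dotProduct, mul_comm] using congrFun hker i)
  funext j
  exact DFunLike.congr_fun hzero j

/-- For every symplectic `2n×2n` matrix `U` over `F₂` there is a vector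
`h ∈ F₂^n` such that the top-left `n×n` block of `U · U_H(h)` is invertible. -/
theorem exists_hadamard_layer_topLeft_invertible (n : ℕ)
    (U : Matrix (Fin n ⊕ Fin n) (Fin n ⊕ Fin n) (ZMod 2))
    (hU : U * Omg n * Uᵀ = Omg n) :
    ∃ h : Fin n → ZMod 2, IsUnit ((U * UHmat n h).toBlocks₁₁) := by
  classical
  obtain ⟨A, B, C, D, rfl⟩ : ∃ A B C D, U = fromBlocks A B C D :=
    ⟨_, _, _, _, (fromBlocks_toBlocks U).symm⟩
  simp only [Omg, fromBlocks_transpose, fromBlocks_multiply, mul_zero, mul_one, zero_add,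
    add_zero, fromBlocks_inj] at hU
  obtain ⟨hAB, hAD, -, -⟩ := hU
  have hsymm : A * Bᵀ = B * Aᵀ := by
    have h := eq_neg_of_add_eq_zero_right hAB
    rwa [ZModModule.neg_eq_self] at h
  obtain ⟨s, hs⟩ := exists_columns_vecMul_eq_zero_imp A B hsymm (fun x hA hB => by
    rw [← vecMul_one x, ← hAD, vecMul_add, ← vecMul_vecMul, ← vecMul_vecMul, hA, hB,
      zero_vecMul, zero_vecMul, add_zero])
  refine ⟨fun j => if j ∈ s then 0 else 1, ?_⟩
  rw [UHmat, fromBlocks_multiply, toBlocks_fromBlocks₁₁, ← vecMul_injective_iff_isUnit]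
  refine (injective_iff_map_eq_zero (Matrix.vecMulLinear (R := ZMod 2) _)).2 fun x hx => ?_
  have hcol (j : Fin n) := congrFun hx j
  simp only [vecMulLinear_apply, vecMul_add, ← vecMul_vecMul, vecMul_diagonal, Pi.add_apply,
    Pi.one_apply, Pi.zero_apply] at hcol
  refine hs x (fun j hj => by simpa [hj] using hcol j) (fun j hj => ?_)
  simpa [hj, CharTwo.add_self_eq_zero] using hcol j
end
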